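/- For persistence diagrams a,b ∈ D^p (integer-valued locally finite point measures on Ω with finite p-th persistence), the optimal partial transport distance OT_p(a,b) equals the classical p-th Wasserstein diagram distance d_p(a,b), defined as the infimum over partial matchings π (bijections between a ∪ ∂Ω and b ∪ ∂Ω) of (Σ_{x ∈ a∪∂Ω} ‖x − π(x)‖^p)^{1/p}. -/

import Mathlib

noncomputable section

open MeasureTheory Metric Set Filter Topology ENNReal
open scoped Classical

/-- The plane with the Euclidean distance. -/
abbrev Pt : Type := EuclideanSpace ℝ (Fin 2)

/-- Build a point of the plane from coordinates. -/
def mk2 (a b : ℝ) : Pt := (WithLp.equiv 2 (Fin 2 → ℝ)).symm ![a, b]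

/-- The open upper half-plane Ω = {(t₁,t₂) : t₂ > t₁}. -/
def UHP : Set Pt := {x | x 0 < x 1}

/-- The diagonal ∂Ω = {(t,t)}. -/
def Diag : Set Pt := {x | x 0 = x 1}

/-- Ω̄ = Ω ∪ ∂Ω. -/
def UHPbar : Set Pt := UHP ∪ Diag

/-- Distance from a point to the diagonal. -/
def persDist (x : Pt) : ℝ := infDist x Diag

/-- p-th total persistence Pers_p(μ) = ∫_Ω d(x,∂Ω)^p dμ(x). -/
def Pers (p : ℝ) (μ : Measure Pt) : ℝ≥0∞ :=
  ∫⁻ x in UHP, ENNReal.ofReal (persDist x ^ p) ∂μ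

/-- μ ∈ M^p : a measure supported on Ω with finite p-th persistence. -/
def MemMp (p : ℝ) (μ : Measure Pt) : Prop := μ UHPᶜ = 0 ∧ Pers p μ < ⊤

/-- Admissible partial transport plans between μ and ν: measures on Ω̄ × Ω̄ whose
marginals restricted to Ω are μ and ν. -/
def Adm (μ ν : Measure Pt) : Set (Measure (Pt × Pt)) :=
  {π | π ((UHPbar ×ˢ UHPbar)ᶜ) = 0 ∧
    (∀ A : Set Pt, MeasurableSet A → A ⊆ UHP → π (A ×ˢ univ) = μ A) ∧
    (∀ B : Set Pt, MeasurableSet B → B ⊆ UHP → π (univ ×ˢ B) = ν B)}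

/-- Cost C_p(π) = ∬ d(x,y)^p dπ(x,y). -/
def Cost (p : ℝ) (π : Measure (Pt × Pt)) : ℝ≥0∞ :=
  ∫⁻ z, ENNReal.ofReal (dist z.1 z.2 ^ p) ∂π

/-- OT_p(μ,ν)^p, as an extended real. -/
def OTe (p : ℝ) (μ ν : Measure Pt) : ℝ≥0∞ := ⨅ π ∈ Adm μ ν, Cost p π

/-- The optimal partial transport distance OT_p(μ,ν). -/
def OT (p : ℝ) (μ ν : Measure Pt) : ℝ := (OTe p μ ν ^ (1 / p)).toReal

/-- Optimal plans. -/
def OptSet (p : ℝ) (μ ν : Measure Pt) : Set (Measure (Pt × Pt)) :=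
  {π | π ∈ Adm μ ν ∧ Cost p π = OTe p μ ν}

/-- Vague convergence of measures on Ω: convergence of integrals of continuous
functions compactly supported in Ω. -/
def VagueTendsto (μs : ℕ → Measure Pt) (μ : Measure Pt) : Prop :=
  ∀ f : Pt → ℝ, Continuous f → HasCompactSupport f → tsupport f ⊆ UHP →
    Tendsto (fun n => ∫ x, f x ∂(μs n)) atTop (𝓝 (∫ x, f x ∂μ))

/-- E_Ω = (Ω̄ × Ω̄) \ (∂Ω × ∂Ω). -/
def EOm : Set (Pt × Pt) := (UHPbar ×ˢ UHPbar) \ (Diag ×ˢ Diag)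

/-- Vague convergence of plans on E_Ω. -/
def VaguePlanTendsto (πs : ℕ → Measure (Pt × Pt)) (π : Measure (Pt × Pt)) : Prop :=
  ∀ f : Pt × Pt → ℝ, Continuous f → HasCompactSupport f → tsupport f ⊆ EOm →
    Tendsto (fun n => ∫ z, f z ∂(πs n)) atTop (𝓝 (∫ z, f z ∂π))

/-- A persistence diagram: an ℕ-valued point measure Σ_{x ∈ X} n_x δ_x with
X ⊆ Ω locally finite in Ω. -/
def IsDiagram (μ : Measure Pt) : Prop :=
  ∃ (X : Set Pt) (n : Pt → ℕ), X ⊆ UHP ∧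
    (∀ x ∈ UHP, ∃ U ∈ 𝓝 x, (X ∩ U).Finite) ∧
    μ = Measure.sum (fun x : X => (n x.1 : ℝ≥0∞) • Measure.dirac (x.1 : Pt))

/-- Support of a measure on Pt × Pt. -/
def msupp (π : Measure (Pt × Pt)) : Set (Pt × Pt) := {z | ∀ U ∈ 𝓝 z, π U ≠ 0}

/-- Support of a measure on Pt. -/
def suppM (μ : Measure Pt) : Set Pt := {x | ∀ U ∈ 𝓝 x, μ U ≠ 0}

/-- Bottleneck cost of a plan: sup of d(x,y) over the support. -/
def CostInf (π : Measure (Pt × Pt)) : ℝ≥0∞ :=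
  ⨆ z ∈ msupp π, ENNReal.ofReal (dist z.1 z.2)

/-- The bottleneck (∞) optimal partial transport distance, as extended real. -/
def OTinfE (μ ν : Measure Pt) : ℝ≥0∞ := ⨅ π ∈ Adm μ ν, CostInf π

/-- μ ∈ M^∞ : support at bounded distance from the diagonal. -/
def MemMinf (μ : Measure Pt) : Prop :=
  μ UHPᶜ = 0 ∧ ∃ C : ℝ, ∀ x ∈ suppM μ, persDist x ≤ C

/-- A partial matching between two indexed families: a bijection between
subsets of the index sets; unmatched points are sent to the diagonal. -/
structure Matching (ι κ : Type*) where
  I : Set ι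
  J : Set κ
  e : I ≃ J

/-- Cost of a partial matching for d_p (as the p-th power, extended real). -/
def mCost (p : ℝ) {ι κ : Type*} (x : ι → Pt) (y : κ → Pt) (m : Matching ι κ) : ℝ≥0∞ :=
  (∑' i : m.I, ENNReal.ofReal (dist (x i.1) (y (m.e i).1) ^ p))
  + (∑' i : ↥(m.Iᶜ), ENNReal.ofReal (persDist (x i.1) ^ p))
  + (∑' j : ↥(m.Jᶜ), ENNReal.ofReal (persDist (y j.1) ^ p))

/-- Bottleneck cost of a partial matching. -/
def mCostInf {ι κ : Type*} (x : ι → Pt) (y : κ → Pt) (m : Matching ι κ) : ℝ≥0∞ :=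
  (⨆ i : m.I, ENNReal.ofReal (dist (x i.1) (y (m.e i).1)))
  ⊔ (⨆ i : ↥(m.Iᶜ), ENNReal.ofReal (persDist (x i.1)))
  ⊔ (⨆ j : ↥(m.Jᶜ), ENNReal.ofReal (persDist (y j.1)))

/-- The point measure associated to an indexed family of points. -/
def famMeasure {ι : Type*} (x : ι → Pt) : Measure Pt :=
  Measure.sum (fun i => Measure.dirac (x i))

/-- The weighted measure μ^p, with density d(x,∂Ω)^p with respect to μ. -/
def wgt (p : ℝ) (μ : Measure Pt) : Measure Pt :=
  μ.withDensity (fun x => ENNReal.ofReal (persDist x ^ p))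

/-- The quotient space Ω̃ = Ω ⊔ {∂Ω}. -/
def Qt : Type := Option ↥UHP

/-- The quotient metric ρ on Ω̃. -/
def ρQ : Qt → Qt → ℝ
  | some x, some y => min (dist (x : Pt) (y : Pt)) (persDist x + persDist y)
  | some x, none => persDist x
  | none, some y => persDist y
  | none, none => 0

/-- The quotient metric ρ viewed on the plane, all diagonal points being
identified. -/
def ρP (x y : Pt) : ℝ :=
  if x ∈ Diag then (if y ∈ Diag then 0 else persDist y)
  else if y ∈ Diag then persDist x
  else min (dist x y) (persDist x + persDist y)

/-- Couplings with full (equal-mass) marginals. -/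
def Coup (μ ν : Measure Pt) : Set (Measure (Pt × Pt)) :=
  {π | π.map Prod.fst = μ ∧ π.map Prod.snd = ν}

/-- The p-Wasserstein distance (to the p) for the quotient metric ρ. -/
def WpE (p : ℝ) (μ ν : Measure Pt) : ℝ≥0∞ :=
  ⨅ π ∈ Coup μ ν, ∫⁻ z, ENNReal.ofReal (ρP z.1 z.2 ^ p) ∂π


open scoped NNReal

/-- A doubly stochastic matrix dominates some permutation in cost. -/
theorem exists_perm_cost_le {n : Type} [Fintype n] (M : Matrix n n ℝ)
    (hM : M ∈ doublyStochastic ℝ n) (C : n → n → ℝ) :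
    ∃ σ : Equiv.Perm n, ∑ k, C k (σ k) ≤ ∑ k, ∑ l, M k l * C k l := by
  obtain ⟨w, hw0, hw1, hw⟩ := exists_eq_sum_perm_of_mem_doublyStochastic hM
  have key : ∑ k, ∑ l, M k l * C k l = ∑ σ, w σ * ∑ k, C k (σ k) := by
    rw [← hw]
    simp only [Matrix.sum_apply, Matrix.smul_apply, Finset.sum_mul, Finset.mul_sum, smul_eq_mul]
    calc _ = ∑ k, ∑ σ, ∑ l, w σ * (σ.permMatrix ℝ) k l * C k l := by
          refine Finset.sum_congr rfl fun k _ => Finset.sum_comm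
      _ = ∑ σ, ∑ k, ∑ l, w σ * (σ.permMatrix ℝ) k l * C k l := Finset.sum_comm
      _ = _ := by
          refine Finset.sum_congr rfl fun σ _ => Finset.sum_congr rfl fun k _ => ?_
          simp [Equiv.Perm.permMatrix, PEquiv.toMatrix_apply, Equiv.toPEquiv_apply]
  by_contra! h
  rw [key] at h
  have h1 : ∑ τ, w τ * (∑ σ, w σ * ∑ k, C k (σ k)) < ∑ τ, w τ * ∑ k, C k (τ k) := by
    apply Finset.sum_lt_sum
    · intro τ _
      exact mul_le_mul_of_nonneg_left (h τ).le (hw0 τ)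
    · by_contra! h2
      have : ∀ τ, w τ = 0 := by
        intro τ
        by_contra hne
        have hpos : 0 < w τ := lt_of_le_of_ne (hw0 τ) (Ne.symm hne)
        exact absurd (h2 τ (Finset.mem_univ _)) (not_le.2 (mul_lt_mul_of_pos_left (h τ) hpos))
      simp [this] at hw1
  rw [← Finset.sum_mul, hw1, one_mul] at h1
  exact lt_irrefl _ h1

/-- The cost of the first kind of rows. -/
def rowCost {F G : Type} (c : F → G → ℝ≥0) (f : F → ℝ≥0) (i : F) : F ⊕ G → ℝ≥0
  | Sum.inl _ => f i
  | Sum.inr j => c i j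

/-- The cost of a column `j` in terms of its row. -/
def colCost {F G : Type} (g : G → ℝ≥0) (j : G) : F ⊕ G → ℝ≥0
  | Sum.inl _ => 0
  | Sum.inr _ => g j

theorem exists_perm_partial {F G : Type} [Fintype F] [Fintype G] (a : F → G → ℝ≥0)
    (r : F → ℝ≥0) (s : G → ℝ≥0) (hr : ∀ i, ∑ j, a i j + r i = 1) (hs : ∀ j, ∑ i, a i j + s j = 1)
    (c : F → G → ℝ≥0) (f : F → ℝ≥0) (g : G → ℝ≥0) :
    ∃ σ : Equiv.Perm (F ⊕ G),
      ∑ i, rowCost c f i (σ (Sum.inl i)) + ∑ j, colCost g j (σ.symm (Sum.inr j))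
        ≤ ∑ i, ∑ j, a i j * c i j + ∑ i, r i * f i + ∑ j, s j * g j := by
  let M : Matrix (F ⊕ G) (F ⊕ G) ℝ := Matrix.fromBlocks (Matrix.diagonal fun i => (r i : ℝ))
    (Matrix.of fun i j => (a i j : ℝ)) (Matrix.of fun j i => (a i j : ℝ))
    (Matrix.diagonal fun j => (s j : ℝ))
  have hr' : ∀ i, ∑ j, (a i j : ℝ) + r i = 1 := fun i => by exact_mod_cast hr i
  have hs' : ∀ j, ∑ i, (a i j : ℝ) + s j = 1 := fun i => by exact_mod_cast hs i
  have hM : M ∈ doublyStochastic ℝ (F ⊕ G) := by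
    rw [mem_doublyStochastic_iff_sum]
    refine ⟨?_, ?_, ?_⟩
    · rintro (i | j) (i' | j')
      · simp only [M, Matrix.fromBlocks_apply₁₁, Matrix.diagonal_apply]; split_ifs <;> positivity
      · simp [M]
      · simp [M]
      · simp only [M, Matrix.fromBlocks_apply₂₂, Matrix.diagonal_apply]; split_ifs <;> positivity
    · rintro (i | j)
      · simp [M, Fintype.sum_sum_type, Matrix.diagonal_apply, ← hr' i, add_comm]
      · simp [M, Fintype.sum_sum_type, Matrix.diagonal_apply, ← hs' j, add_comm]
    · rintro (i | j)
      · simp [M, Fintype.sum_sum_type, Matrix.diagonal_apply, ← hr' i, add_comm]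
      · simp [M, Fintype.sum_sum_type, Matrix.diagonal_apply, ← hs' j, add_comm]
  let C1 : F ⊕ G → F ⊕ G → ℝ := fun k l => Sum.elim (fun i => (rowCost c f i l : ℝ)) (fun _ => 0) k
  let C2 : F ⊕ G → F ⊕ G → ℝ := fun k l => Sum.elim (fun _ => 0) (fun j => (colCost g j k : ℝ)) l
  obtain ⟨σ, hσ⟩ := exists_perm_cost_le M hM (fun k l => C1 k l + C2 k l)
  refine ⟨σ, ?_⟩
  have e1 : ∑ k, C1 k (σ k) = ∑ i, (rowCost c f i (σ (Sum.inl i)) : ℝ) := by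
    simp [C1, Fintype.sum_sum_type]
  have e2 : ∑ k, C2 k (σ k) = ∑ j, (colCost g j (σ.symm (Sum.inr j)) : ℝ) := by
    rw [← Equiv.sum_comp σ.symm]
    simp [C2, Fintype.sum_sum_type]
  have e3 : ∑ k, ∑ l, M k l * (C1 k l + C2 k l) =
      ∑ i, ∑ j, (a i j : ℝ) * c i j + ∑ i, (r i : ℝ) * f i + ∑ j, (s j : ℝ) * g j := by
    simp [M, C1, C2, rowCost, colCost, Fintype.sum_sum_type, Matrix.diagonal_apply,
      Finset.sum_add_distrib]
    ring
  rw [Finset.sum_add_distrib, e1, e2, e3] at hσ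
  exact_mod_cast hσ

/-- abstract matching cost -/
def absCost {ι κ : Type} (c : ι → κ → ℝ≥0∞) (f : ι → ℝ≥0∞) (g : κ → ℝ≥0∞)
    (m : Matching ι κ) : ℝ≥0∞ :=
  (∑' i : m.I, c i.1 (m.e i).1) + (∑' i : ↥(m.Iᶜ), f i.1) + (∑' j : ↥(m.Jᶜ), g j.1)

theorem absCost_of_perm {ι κ : Type} (c : ι → κ → ℝ≥0) (f : ι → ℝ≥0) (g : κ → ℝ≥0)
    (F : Finset ι) (G : Finset κ) (σ : Equiv.Perm (F ⊕ G)) :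
    ∃ m : Matching ι κ, absCost (fun i j => (c i j : ℝ≥0∞)) (fun i => f i) (fun j => g j) m ≤
      ((∑ i : F, rowCost (fun (i : F) (j : G) => c i j) (fun i : F => f i) i (σ (Sum.inl i)) +
        ∑ j : G, colCost (fun j : G => g j) j (σ.symm (Sum.inr j)) : ℝ≥0) : ℝ≥0∞) +
      ∑' i : ↥((F : Set ι)ᶜ), (f i : ℝ≥0∞) + ∑' j : ↥((G : Set κ)ᶜ), (g j : ℝ≥0∞) := by
  let I : Set ι := {i | ∃ h : i ∈ F, ∃ j, σ (Sum.inl ⟨i, h⟩) = Sum.inr j}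
  have hI : ∀ i : I, ∃ j : G, σ (Sum.inl ⟨i.1, i.2.1⟩) = Sum.inr j := fun i => i.2.2
  choose φ hφ using hI
  have hinj : Function.Injective (fun i : I => (φ i : κ)) := by
    intro i i' h
    have h' : φ i = φ i' := Subtype.ext h
    have := hφ i
    rw [h', ← hφ i'] at this
    have := σ.injective this
    simp at this
    exact Subtype.ext this
  refine ⟨⟨I, range (fun i : I => (φ i : κ)), Equiv.ofInjective _ hinj⟩, ?_⟩
  let H : ι → ℝ≥0 := fun i => if h : i ∈ I then c i (φ ⟨i, h⟩) else f i
  have h1 : (∑' i : I, (c i.1 (φ i) : ℝ≥0∞)) + (∑' i : ↥(Iᶜ), (f i.1 : ℝ≥0∞)) =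
      ∑' i, (H i : ℝ≥0∞) := by
    rw [← ENNReal.summable.tsum_add_tsum_compl (s := I) (f := fun i => (H i : ℝ≥0∞))
      ENNReal.summable]
    congr 1
    · refine tsum_congr fun i => ?_
      simp [H]
    · refine tsum_congr fun i => ?_
      have : i.1 ∉ I := i.2
      simp [H, this]
  have h2 : ∑' i, (H i : ℝ≥0∞) = ((∑ i : F, rowCost (fun (i : F) (j : G) => c i j)
      (fun i : F => f i) i (σ (Sum.inl i)) : ℝ≥0) : ℝ≥0∞)
      + ∑' i : ↥((F : Set ι)ᶜ), (f i : ℝ≥0∞) := by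
    rw [← ENNReal.sum_add_tsum_compl F]
    congr 1
    · push_cast
      rw [← Finset.sum_coe_sort]
      refine Finset.sum_congr rfl fun i _ => ?_
      congr 1
      by_cases h : i.1 ∈ I
      · have := hφ ⟨i, h⟩
        simp only [Subtype.coe_eta] at this
        simp [H, h, this, rowCost]
      · rcases h' : σ (Sum.inl i) with k | k
        · simp [H, h, rowCost]
        · exact absurd ⟨i.2, k, h'⟩ h
    · refine tsum_congr fun i => ?_
      have : i.1 ∉ I := fun h => i.2 h.1
      simp [H, this]
  have h3 : ∑' j : ↥((range (fun i : I => (φ i : κ)))ᶜ), (g j : ℝ≥0∞) ≤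
      ((∑ j : G, colCost (fun j : G => g j) j (σ.symm (Sum.inr j)) : ℝ≥0) : ℝ≥0∞)
       + ∑' j : ↥((G : Set κ)ᶜ), (g j : ℝ≥0∞) := by
    rw [tsum_subtype _ (fun j => (g j : ℝ≥0∞)), ← ENNReal.sum_add_tsum_compl G]
    refine add_le_add ?_ (ENNReal.tsum_le_tsum fun j => indicator_le_self _ _ _)
    push_cast
    rw [← Finset.sum_coe_sort]
    refine Finset.sum_le_sum fun j _ => ?_
    rcases h' : σ.symm (Sum.inr j) with k | k
    · have h4 : σ (Sum.inl k) = Sum.inr j := by rw [← h']; simp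
      have hk : k.1 ∈ I := ⟨k.2, j, h4⟩
      have : j.1 ∈ range (fun i : I => (φ i : κ)) := by
        refine ⟨⟨k, hk⟩, ?_⟩
        have := hφ ⟨k, hk⟩
        simp only [Subtype.coe_eta] at this
        rw [h4] at this
        simp at this
        simp [← this]
      rw [indicator_of_notMem (by simpa using this)]
      simp
    · simpa [colCost] using indicator_le_self _ (fun j => (g j : ℝ≥0∞)) j.1
  unfold absCost
  simp only [Equiv.ofInjective_apply]
  rw [h1, h2]
  refine (add_le_add le_rfl h3).trans (le_of_eq ?_)
  push_cast
  ring

theorem exists_finset_tail {α : Type} (h : α → ℝ≥0∞) (hh : ∑' x, h x ≠ ∞) (ε : ℝ≥0∞)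
    (hε : 0 < ε) : ∃ S : Finset α, ∀ T : Set α, (∀ x ∈ S, x ∉ T) → ∑' x : T, h x ≤ ε := by
  obtain ⟨S, hS⟩ := ((tendsto_order.1 (ENNReal.tendsto_tsum_compl_atTop_zero hh)).2 ε hε).exists
  refine ⟨S, fun T hT => le_trans ?_ hS.le⟩
  exact ENNReal.tsum_mono_subtype h (s := T) (t := {x | x ∉ S}) (fun x hx hxS => hT x hxS hx)

theorem iInf_absCost_le {ι κ : Type} (a : ι → κ → ℝ≥0∞) (r : ι → ℝ≥0∞) (s : κ → ℝ≥0∞)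
    (hr : ∀ i, ∑' j, a i j + r i = 1) (hs : ∀ j, ∑' i, a i j + s j = 1)
    (c : ι → κ → ℝ≥0) (f : ι → ℝ≥0) (g : κ → ℝ≥0)
    (hf : ∑' i, (f i : ℝ≥0∞) ≠ ∞) (hg : ∑' j, (g j : ℝ≥0∞) ≠ ∞) :
    ⨅ m : Matching ι κ, absCost (fun i j => (c i j : ℝ≥0∞)) (fun i => f i) (fun j => g j) m ≤
      ∑' i, ∑' j, a i j * c i j + ∑' i, r i * f i + ∑' j, s j * g j := by
  refine ENNReal.le_of_forall_pos_le_add fun ε hε _ => ?_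
  have hε4 : (0 : ℝ≥0∞) < ((ε / 4 : ℝ≥0) : ℝ≥0∞) := by
    rw [ENNReal.coe_pos]; positivity
  have haf : ∑' q : ι × κ, a q.1 q.2 * f q.1 ≠ ∞ := by
    rw [ENNReal.tsum_prod (f := fun i j => a i j * (f i : ℝ≥0∞))]
    refine ne_top_of_le_ne_top hf (ENNReal.tsum_le_tsum fun i => ?_)
    rw [ENNReal.tsum_mul_right]
    calc _ ≤ 1 * (f i : ℝ≥0∞) := by gcongr; rw [← hr i]; exact le_self_add
      _ = _ := one_mul _
  have hag : ∑' q : ι × κ, a q.1 q.2 * g q.2 ≠ ∞ := by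
    rw [ENNReal.tsum_prod (f := fun i j => a i j * (g j : ℝ≥0∞)), ENNReal.tsum_comm]
    refine ne_top_of_le_ne_top hg (ENNReal.tsum_le_tsum fun i => ?_)
    rw [ENNReal.tsum_mul_right]
    calc _ ≤ 1 * (g i : ℝ≥0∞) := by gcongr; rw [← hs i]; exact le_self_add
      _ = _ := one_mul _
  obtain ⟨S1, hS1⟩ := exists_finset_tail _ haf _ hε4
  obtain ⟨S2, hS2⟩ := exists_finset_tail _ hag _ hε4
  obtain ⟨F0, hF0⟩ := exists_finset_tail _ hf _ hε4
  obtain ⟨G0, hG0⟩ := exists_finset_tail _ hg _ hε4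
  let F : Finset ι := F0 ∪ S1.image Prod.fst ∪ S2.image Prod.fst
  let G : Finset κ := G0 ∪ S1.image Prod.snd ∪ S2.image Prod.snd
  have hF1 : ∀ q ∈ S1, q.1 ∈ F := fun q hq => by
    simp only [F, Finset.mem_union, Finset.mem_image]; exact Or.inl (Or.inr ⟨q, hq, rfl⟩)
  have hF2 : ∀ q ∈ S2, q.1 ∈ F := fun q hq => by
    simp only [F, Finset.mem_union, Finset.mem_image]; exact Or.inr ⟨q, hq, rfl⟩
  have hG1 : ∀ q ∈ S1, q.2 ∈ G := fun q hq => by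
    simp only [G, Finset.mem_union, Finset.mem_image]; exact Or.inl (Or.inr ⟨q, hq, rfl⟩)
  have hG2 : ∀ q ∈ S2, q.2 ∈ G := fun q hq => by
    simp only [G, Finset.mem_union, Finset.mem_image]; exact Or.inr ⟨q, hq, rfl⟩
  have tf : ∑' i : ↥((F : Set ι)ᶜ), (f i : ℝ≥0∞) ≤ ((ε / 4 : ℝ≥0) : ℝ≥0∞) :=
    hF0 _ fun x hx h => h (by simp [F, hx])
  have tg : ∑' j : ↥((G : Set κ)ᶜ), (g j : ℝ≥0∞) ≤ ((ε / 4 : ℝ≥0) : ℝ≥0∞) :=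
    hG0 _ fun x hx h => h (by simp [G, hx])
  clear_value F G
  let R : ι → ℝ≥0∞ := fun i => r i + ∑' j : ↥((G : Set κ)ᶜ), a i j
  let S : κ → ℝ≥0∞ := fun j => s j + ∑' i : ↥((F : Set ι)ᶜ), a i j
  have hR : ∀ i, ∑ j : G, a i j + R i = 1 := fun i => by
    rw [← hr i, ← ENNReal.sum_add_tsum_compl G, Finset.sum_coe_sort G (fun j => a i j)]
    simp only [R]; ring
  have hS : ∀ j, ∑ i : F, a i j + S j = 1 := fun j => by
    rw [← hs j, ← ENNReal.sum_add_tsum_compl F, Finset.sum_coe_sort F (fun i => a i j)]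
    simp only [S]; ring
  have aR : ∑ i : F, R i * f i ≤ ∑' i, r i * f i + ((ε / 4 : ℝ≥0) : ℝ≥0∞) := by
    simp only [R, add_mul, Finset.sum_add_distrib]
    refine add_le_add ?_ ?_
    · rw [Finset.sum_coe_sort F (fun i => r i * (f i : ℝ≥0∞))]
      exact ENNReal.sum_le_tsum _
    · refine le_trans ?_ (hS1 {q | q.1 ∈ F ∧ q.2 ∉ G} fun q hq h => h.2 (hG1 q hq))
      simp only [← ENNReal.tsum_mul_right]
      rw [← tsum_fintype (L := .unconditional _),
        ← ENNReal.tsum_prod (f := fun (i : F) (j : ↥((G : Set κ)ᶜ)) => a i j * (f i : ℝ≥0∞))]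
      let Φ : F × ↥((G : Set κ)ᶜ) → {q : ι × κ | q.1 ∈ F ∧ q.2 ∉ G} :=
        fun q => ⟨(q.1, q.2), q.1.2, q.2.2⟩
      have hΦ : Function.Injective Φ := by
        rintro ⟨i, j⟩ ⟨i', j'⟩ h
        have h1 : (i : ι) = i' := congrArg (fun z => z.1.1) h
        have h2 : (j : κ) = j' := congrArg (fun z => z.1.2) h
        exact Prod.ext (Subtype.ext h1) (Subtype.ext h2)
      exact ENNReal.tsum_comp_le_tsum_of_injective hΦ (fun q => a q.1.1 q.1.2 * (f q.1.1 : ℝ≥0∞))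
  have aS : ∑ j : G, S j * g j ≤ ∑' j, s j * g j + ((ε / 4 : ℝ≥0) : ℝ≥0∞) := by
    simp only [S, add_mul, Finset.sum_add_distrib]
    refine add_le_add ?_ ?_
    · rw [Finset.sum_coe_sort G (fun i => s i * (g i : ℝ≥0∞))]
      exact ENNReal.sum_le_tsum _
    · refine le_trans ?_ (hS2 {q | q.1 ∉ F ∧ q.2 ∈ G} fun q hq h => h.1 (hF2 q hq))
      simp only [← ENNReal.tsum_mul_right]
      rw [← tsum_fintype (L := .unconditional _),
        ← ENNReal.tsum_prod (f := fun (j : G) (i : ↥((F : Set ι)ᶜ)) => a i j * (g j : ℝ≥0∞))]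
      let Φ : G × ↥((F : Set ι)ᶜ) → {q : ι × κ | q.1 ∉ F ∧ q.2 ∈ G} :=
        fun q => ⟨(q.2, q.1), q.2.2, q.1.2⟩
      have hΦ : Function.Injective Φ := by
        rintro ⟨i, j⟩ ⟨i', j'⟩ h
        have h1 : (j : ι) = j' := congrArg (fun z => z.1.1) h
        have h2 : (i : κ) = i' := congrArg (fun z => z.1.2) h
        exact Prod.ext (Subtype.ext h2) (Subtype.ext h1)
      exact ENNReal.tsum_comp_le_tsum_of_injective hΦ (fun q => a q.1.1 q.1.2 * (g q.1.2 : ℝ≥0∞))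
  have aA : ∑ i : F, ∑ j : G, a i j * c i j ≤ ∑' i, ∑' j, a i j * c i j := by
    rw [Finset.sum_coe_sort F (fun i => ∑ j : G, a i j * (c i j : ℝ≥0∞))]
    refine le_trans (Finset.sum_le_sum fun i _ => ?_) (ENNReal.sum_le_tsum F)
    rw [Finset.sum_coe_sort G (fun j => a i j * (c i j : ℝ≥0∞))]
    exact ENNReal.sum_le_tsum G
  have ha1 : ∀ i j, a i j ≠ ∞ := fun i j => by
    refine ne_top_of_le_ne_top one_ne_top ?_
    rw [← hr i]
    exact (ENNReal.le_tsum j).trans le_self_add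
  have hR1 : ∀ i, R i ≠ ∞ := fun i =>
    ne_top_of_le_ne_top one_ne_top (by rw [← hR i]; exact le_add_self)
  have hSt : ∀ i, S i ≠ ∞ := fun i =>
    ne_top_of_le_ne_top one_ne_top (by rw [← hS i]; exact le_add_self)
  clear_value R S
  lift a to ι → κ → ℝ≥0 using ha1
  lift R to ι → ℝ≥0 using hR1
  lift S to κ → ℝ≥0 using hSt
  beta_reduce at hR hS aA aR aS
  obtain ⟨σ, hσ⟩ := exists_perm_partial (F := F) (G := G) (fun i j => a i j) (fun i => R i)
    (fun j => S j) (fun i => by exact_mod_cast hR i) (fun j => by exact_mod_cast hS j)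
    (fun i j => c i j) (fun i => f i) (fun j => g j)
  obtain ⟨m, hm⟩ := absCost_of_perm c f g F G σ
  refine (iInf_le _ m).trans (hm.trans ?_)
  have hσ' := ENNReal.coe_le_coe.2 hσ
  refine (add_le_add (add_le_add hσ' tf) tg).trans ?_
  have h4 : (ε : ℝ≥0∞) = ((ε / 4 : ℝ≥0) : ℝ≥0∞) + ((ε / 4 : ℝ≥0) : ℝ≥0∞)
      + ((ε / 4 : ℝ≥0) : ℝ≥0∞) + ((ε / 4 : ℝ≥0) : ℝ≥0∞) := by
    rw [← ENNReal.coe_add, ← ENNReal.coe_add, ← ENNReal.coe_add]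
    congr 1
    ring
  rw [h4]
  push_cast
  push_cast at aA aR aS
  calc _ ≤ _ := add_le_add (add_le_add (add_le_add (add_le_add aA aR) aS) le_rfl) le_rfl
    _ = _ := by ring

theorem isOpen_UHP : IsOpen UHP := by
  unfold UHP
  exact isOpen_lt (by fun_prop) (by fun_prop)

theorem isClosed_Diag : IsClosed Diag := by
  unfold Diag
  exact isClosed_eq (by fun_prop) (by fun_prop)

theorem measurableSet_UHPbar : MeasurableSet UHPbar :=
  isOpen_UHP.measurableSet.union isClosed_Diag.measurableSet

theorem Diag_nonempty : Diag.Nonempty := ⟨0, by simp [Diag]⟩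

theorem notMem_UHP_of_Diag {x : Pt} (h : x ∈ Diag) : x ∉ UHP := by
  intro h'
  simp only [Diag, UHP, mem_ofPred_eq] at h h'
  exact absurd h h'.ne

theorem exists_proj (x : Pt) : ∃ z ∈ Diag, persDist x = dist x z :=
  isClosed_Diag.exists_infDist_eq_dist Diag_nonempty x

theorem famMeasure_apply {ι : Type} (x : ι → Pt) {A : Set Pt} (hA : MeasurableSet A) :
    famMeasure x A = ∑' i, A.indicator 1 (x i) := by
  unfold famMeasure
  rw [Measure.sum_apply _ hA]
  exact tsum_congr fun i => Measure.dirac_apply' _ hA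

theorem measurable_cost (p : ℝ) :
    Measurable fun z : Pt × Pt => ENNReal.ofReal (dist z.1 z.2 ^ p) := by
  fun_prop

theorem measurable_pers (p : ℝ) : Measurable fun z : Pt => ENNReal.ofReal (persDist z ^ p) := by
  unfold persDist
  fun_prop

/-- A family of pairs as a point measure. -/
def pairMeasure {α : Type} (u v : α → Pt) : Measure (Pt × Pt) :=
  Measure.sum (fun i => Measure.dirac (u i, v i))

theorem pairMeasure_apply {α : Type} (u v : α → Pt) {A : Set (Pt × Pt)} (hA : MeasurableSet A) :
    pairMeasure u v A = ∑' i, A.indicator 1 (u i, v i) := by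
  unfold pairMeasure
  rw [Measure.sum_apply _ hA]
  exact tsum_congr fun i => Measure.dirac_apply' _ hA

theorem pairMeasure_left {α : Type} (u v : α → Pt) {A : Set Pt} (hA : MeasurableSet A) :
    pairMeasure u v (A ×ˢ univ) = ∑' i, A.indicator 1 (u i) := by
  rw [pairMeasure_apply _ _ (hA.prod MeasurableSet.univ)]
  refine tsum_congr fun i => ?_
  simp [indicator_apply]

theorem pairMeasure_right {α : Type} (u v : α → Pt) {A : Set Pt} (hA : MeasurableSet A) :
    pairMeasure u v (univ ×ˢ A) = ∑' i, A.indicator 1 (v i) := by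
  rw [pairMeasure_apply _ _ (MeasurableSet.univ.prod hA)]
  refine tsum_congr fun i => ?_
  simp [indicator_apply]

theorem pairMeasure_cost {α : Type} (u v : α → Pt) (p : ℝ) :
    Cost p (pairMeasure u v) = ∑' i, ENNReal.ofReal (dist (u i) (v i) ^ p) := by
  unfold Cost pairMeasure
  rw [lintegral_sum_measure]
  refine tsum_congr fun i => ?_
  rw [lintegral_dirac' _ (measurable_cost p)]

theorem pairMeasure_supp {α : Type} (u v : α → Pt) (hu : ∀ i, u i ∈ UHPbar)
    (hv : ∀ i, v i ∈ UHPbar) : pairMeasure u v ((UHPbar ×ˢ UHPbar)ᶜ) = 0 := by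
  rw [pairMeasure_apply _ _ (measurableSet_UHPbar.prod measurableSet_UHPbar).compl]
  simp [hu, hv]

theorem OTe_le {ι κ : Type} (p : ℝ)
    (x : ι → Pt) (y : κ → Pt) (hx : ∀ i, x i ∈ UHP) (hy : ∀ j, y j ∈ UHP) (m : Matching ι κ) :
    OTe p (famMeasure x) (famMeasure y) ≤ mCost p x y m := by
  choose P hPD hP using exists_proj
  let π1 := pairMeasure (fun i : m.I => x i) (fun i => y (m.e i))
  let π2 := pairMeasure (fun i : ↥(m.Iᶜ) => x i) (fun i => P (x i))
  let π3 := pairMeasure (fun i : ↥(m.Jᶜ) => P (y i)) (fun i => y i)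
  have hxb : ∀ i, x i ∈ UHPbar := fun i => Or.inl (hx i)
  have hyb : ∀ i, y i ∈ UHPbar := fun i => Or.inl (hy i)
  have hPb : ∀ z, P z ∈ UHPbar := fun z => Or.inr (hPD z)
  have hz : ∀ A ⊆ UHP, ∀ z, A.indicator (1 : Pt → ℝ≥0∞) (P z) = 0 := fun A hA z =>
    indicator_of_notMem (fun h => notMem_UHP_of_Diag (hPD z) (hA h)) _
  have hadm : π1 + π2 + π3 ∈ Adm (famMeasure x) (famMeasure y) := by
    refine ⟨?_, ?_, ?_⟩
    · simp only [Measure.add_apply, π1, π2, π3]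
      rw [pairMeasure_supp _ _ (fun _ => hxb _) (fun _ => hyb _),
        pairMeasure_supp _ _ (fun _ => hxb _) (fun _ => hPb _),
        pairMeasure_supp _ _ (fun _ => hPb _) (fun _ => hyb _)]
      simp
    · intro A hA hAU
      simp only [Measure.add_apply, π1, π2, π3]
      rw [pairMeasure_left _ _ hA, pairMeasure_left _ _ hA, pairMeasure_left _ _ hA,
        famMeasure_apply _ hA]
      simp only [hz A hAU, tsum_zero, add_zero]
      exact ENNReal.summable.tsum_add_tsum_compl (s := m.I)
        (f := fun i => A.indicator (1 : Pt → ℝ≥0∞) (x i)) ENNReal.summable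
    · intro A hA hAU
      simp only [Measure.add_apply, π1, π2, π3]
      rw [pairMeasure_right _ _ hA, pairMeasure_right _ _ hA, pairMeasure_right _ _ hA,
        famMeasure_apply _ hA]
      simp only [hz A hAU, tsum_zero, add_zero]
      rw [m.e.tsum_eq (fun j : m.J => A.indicator (1 : Pt → ℝ≥0∞) (y j))]
      exact ENNReal.summable.tsum_add_tsum_compl (s := m.J)
        (f := fun i => A.indicator (1 : Pt → ℝ≥0∞) (y i)) ENNReal.summable
  refine (iInf₂_le _ hadm).trans (le_of_eq ?_)
  have : Cost p (π1 + π2 + π3) = Cost p π1 + Cost p π2 + Cost p π3 := by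
    unfold Cost
    rw [lintegral_add_measure, lintegral_add_measure]
  rw [this, pairMeasure_cost, pairMeasure_cost, pairMeasure_cost]
  unfold mCost
  simp only [hP, dist_comm (P _)]

theorem Pers_fam {ι : Type} (p : ℝ) (x : ι → Pt) (hx : ∀ i, x i ∈ UHP) :
    Pers p (famMeasure x) = ∑' i, ENNReal.ofReal (persDist (x i) ^ p) := by
  unfold Pers famMeasure
  rw [Measure.restrict_sum _ isOpen_UHP.measurableSet, lintegral_sum_measure]
  refine tsum_congr fun i => ?_
  rw [Measure.restrict_eq_self_of_ae_mem, lintegral_dirac' _ (measurable_pers p)]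
  simp [ae_dirac_eq, hx i]

theorem fam_ne_top {ι : Type} (x : ι → Pt) (hxd : IsDiagram (famMeasure x)) (u : Pt) :
    famMeasure x {u} ≠ ∞ := by
  obtain ⟨X, n, -, -, h⟩ := hxd
  rw [h, Measure.sum_apply _ (measurableSet_singleton u)]
  by_cases hu : u ∈ X
  · rw [tsum_eq_single ⟨u, hu⟩]
    · simp
    · intro b hb
      have : (b : Pt) ≠ u := fun h => hb (Subtype.ext h)
      simp [this]
  · have : ∀ i : X, (i : Pt) ≠ u := fun i h => hu (h ▸ i.2)
    simp [this]

/-- weights spreading mass evenly over the indices sitting at the same point. -/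
def wt {ι : Type} (x : ι → Pt) (i : ι) : Pt → ℝ≥0∞ :=
  ({x i} : Set Pt).indicator fun _ => (famMeasure x {x i})⁻¹

theorem measurable_wt {ι : Type} (x : ι → Pt) (i : ι) : Measurable (wt x i) :=
  measurable_const.indicator (measurableSet_singleton _)

theorem fam_ne_zero {ι : Type} (x : ι → Pt) (i : ι) : famMeasure x {x i} ≠ 0 := by
  rw [famMeasure_apply _ (measurableSet_singleton _)]
  intro h
  have := ENNReal.tsum_eq_zero.1 h i
  simp at this

theorem tsum_wt {ι : Type} (x : ι → Pt) (hxd : IsDiagram (famMeasure x)) (u : Pt) :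
    ∑' i, wt x i u = (range x).indicator 1 u := by
  by_cases hu : u ∈ range x
  · obtain ⟨k, rfl⟩ := hu
    rw [indicator_of_mem (mem_range_self k), Pi.one_apply]
    have e := famMeasure_apply x (measurableSet_singleton (x k))
    calc ∑' i, wt x i (x k)
        = ∑' i, ({x k} : Set Pt).indicator 1 (x i) * (famMeasure x {x k})⁻¹ := by
          refine tsum_congr fun i => ?_
          by_cases h : x i = x k
          · simp only [wt, h, indicator_of_mem (mem_singleton (x k)), Pi.one_apply, one_mul]
          · rw [indicator_of_notMem (by simpa using h), zero_mul]
            exact indicator_of_notMem (by simpa using Ne.symm h) _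
      _ = famMeasure x {x k} * (famMeasure x {x k})⁻¹ := by rw [ENNReal.tsum_mul_right, ← e]
      _ = 1 := ENNReal.mul_inv_cancel (fam_ne_zero x k) (fam_ne_top x hxd (x k))
  · rw [indicator_of_notMem hu, ENNReal.tsum_eq_zero]
    intro i
    refine indicator_of_notMem (fun h => hu ⟨i, ?_⟩) _
    exact (mem_singleton_iff.1 h).symm

theorem wt_mul_congr {ι : Type} (x : ι → Pt) (i : ι) (u : Pt) (h : Pt → ℝ≥0∞) :
    wt x i u * h (x i) = wt x i u * h u := by
  by_cases hu : u = x i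
  · rw [hu]
  · simp [wt, hu]

theorem fam_compl_range {ι : Type} [Countable ι] (x : ι → Pt) :
    famMeasure x (UHP \ range x) = 0 := by
  rw [famMeasure_apply _ (isOpen_UHP.measurableSet.diff (countable_range x).measurableSet)]
  simp

theorem mm {f g : Pt × Pt → ℝ≥0∞} (hf : Measurable f) (hg : Measurable g) :
    Measurable fun z => f z * g z := hf.mul hg

theorem le_Cost {ι κ : Type} [Countable ι] [Countable κ] (p : ℝ)
    (x : ι → Pt) (y : κ → Pt) (hx : ∀ i, x i ∈ UHP) (hy : ∀ j, y j ∈ UHP)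
    (hxd : IsDiagram (famMeasure x)) (hyd : IsDiagram (famMeasure y)) (hp : 0 ≤ p)
    (hf : ∑' i, ENNReal.ofReal (persDist (x i) ^ p) ≠ ∞)
    (hg : ∑' j, ENNReal.ofReal (persDist (y j) ^ p) ≠ ∞)
    (π : Measure (Pt × Pt)) (hπ : π ∈ Adm (famMeasure x) (famMeasure y)) :
    ⨅ m : Matching ι κ, mCost p x y m ≤ Cost p π := by
  obtain ⟨h0, h1, h2⟩ := hπ
  let D : Pt → ℝ≥0∞ := Diag.indicator 1
  have mD : Measurable D := measurable_one.indicator isClosed_Diag.measurableSet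
  have mX : ∀ i, Measurable fun z : Pt × Pt => wt x i z.1 :=
    fun i => (measurable_wt x i).comp measurable_fst
  have mY : ∀ j, Measurable fun z : Pt × Pt => wt y j z.2 :=
    fun i => (measurable_wt y i).comp measurable_snd
  have mD1 : Measurable fun z : Pt × Pt => D z.1 := mD.comp measurable_fst
  have mD2 : Measurable fun z : Pt × Pt => D z.2 := mD.comp measurable_snd
  have nD : ∀ i, D (x i) = 0 := fun i =>
    indicator_of_notMem (fun h => notMem_UHP_of_Diag h (hx i)) _
  have nD' : ∀ i, D (y i) = 0 := fun i =>
    indicator_of_notMem (fun h => notMem_UHP_of_Diag h (hy i)) _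
  let a : ι → κ → ℝ≥0∞ := fun i j => ∫⁻ z, wt x i z.1 * wt y j z.2 ∂π
  let r : ι → ℝ≥0∞ := fun i => ∫⁻ z, wt x i z.1 * D z.2 ∂π
  let s : κ → ℝ≥0∞ := fun j => ∫⁻ z, D z.1 * wt y j z.2 ∂π
  -- almost everywhere both coordinates are on the diagonal or in the supports
  have hbar : ∀ᵐ z ∂π, z ∈ UHPbar ×ˢ UHPbar := h0
  have hX : ∀ᵐ z ∂π, z.1 ∈ range x ∪ Diag := by
    have : ∀ᵐ z ∂π, z ∉ (UHP \ range x) ×ˢ (univ : Set Pt) := by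
      rw [← measure_eq_zero_iff_ae_notMem]
      rw [h1 _ (isOpen_UHP.measurableSet.diff (countable_range x).measurableSet) sdiff_subset]
      exact fam_compl_range x
    filter_upwards [this, hbar] with z hz hb
    rcases hb.1 with h | h
    · by_contra hc
      exact hz ⟨⟨h, fun h' => hc (Or.inl h')⟩, mem_univ _⟩
    · exact Or.inr h
  have hY : ∀ᵐ z ∂π, z.2 ∈ range y ∪ Diag := by
    have : ∀ᵐ z ∂π, z ∉ (univ : Set Pt) ×ˢ (UHP \ range y) := by
      rw [← measure_eq_zero_iff_ae_notMem]
      rw [h2 _ (isOpen_UHP.measurableSet.diff (countable_range y).measurableSet) sdiff_subset]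
      exact fam_compl_range y
    filter_upwards [this, hbar] with z hz hb
    rcases hb.2 with h | h
    · by_contra hc
      exact hz ⟨mem_univ _, ⟨h, fun h' => hc (Or.inl h')⟩⟩
    · exact Or.inr h
  have sX : ∀ u ∈ range x ∪ Diag, ∑' i, wt x i u + D u = 1 := by
    intro u hu
    rw [tsum_wt x hxd]
    rcases hu with ⟨i, rfl⟩ | h
    · rw [nD i, indicator_of_mem (mem_range_self i)]; simp
    · have h' : u ∉ range x := by
        rintro ⟨i, rfl⟩
        exact notMem_UHP_of_Diag h (hx i)
      rw [indicator_of_notMem h']; simp [D, h]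
  have sY : ∀ u ∈ range y ∪ Diag, ∑' i, wt y i u + D u = 1 := by
    intro u hu
    rw [tsum_wt y hyd]
    rcases hu with ⟨i, rfl⟩ | h
    · rw [nD' i, indicator_of_mem (mem_range_self i)]; simp
    · have h' : u ∉ range y := by
        rintro ⟨i, rfl⟩
        exact notMem_UHP_of_Diag h (hy i)
      rw [indicator_of_notMem h']; simp [D, h]
  have hr : ∀ i, ∑' j, a i j + r i = 1 := by
    intro i
    simp only [a, r]
    rw [← lintegral_tsum (fun j => (mm (mX i) (mY j)).aemeasurable),
      ← lintegral_add_right _ (mm (mX i) mD2)]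
    have : ∫⁻ z, (∑' j, wt x i z.1 * wt y j z.2 + wt x i z.1 * D z.2) ∂π =
        ∫⁻ z, (({x i} : Set Pt) ×ˢ (univ : Set Pt)).indicator
          (fun _ => (famMeasure x {x i})⁻¹) z ∂π := by
      refine lintegral_congr_ae ?_
      filter_upwards [hY] with z hz
      rw [ENNReal.tsum_mul_left, ← mul_add, sY _ hz, mul_one]
      simp [wt, indicator_apply]
    rw [this, lintegral_indicator ((measurableSet_singleton _).prod MeasurableSet.univ),
      setLIntegral_const, h1 _ (measurableSet_singleton _) (singleton_subset_iff.2 (hx i))]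
    exact ENNReal.inv_mul_cancel (fam_ne_zero x i) (fam_ne_top x hxd (x i))
  have hs : ∀ j, ∑' i, a i j + s j = 1 := by
    intro j
    simp only [a, s]
    rw [← lintegral_tsum (fun i => (mm (mX i) (mY j)).aemeasurable),
      ← lintegral_add_right _ (mm mD1 (mY j))]
    have : ∫⁻ z, (∑' i, wt x i z.1 * wt y j z.2 + D z.1 * wt y j z.2) ∂π =
        ∫⁻ z, ((univ : Set Pt) ×ˢ ({y j} : Set Pt)).indicator
          (fun _ => (famMeasure y {y j})⁻¹) z ∂π := by
      refine lintegral_congr_ae ?_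
      filter_upwards [hX] with z hz
      rw [ENNReal.tsum_mul_right, ← add_mul, sX _ hz, one_mul]
      simp [wt, indicator_apply]
    rw [this, lintegral_indicator (MeasurableSet.univ.prod (measurableSet_singleton _)),
      setLIntegral_const, h2 _ (measurableSet_singleton _) (singleton_subset_iff.2 (hy j))]
    exact ENNReal.inv_mul_cancel (fam_ne_zero y j) (fam_ne_top y hyd (y j))
  have key := iInf_absCost_le a r s hr hs (fun i j => Real.toNNReal (dist (x i) (y j) ^ p))
    (fun i => Real.toNNReal (persDist (x i) ^ p)) (fun j => Real.toNNReal (persDist (y j) ^ p))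
    hf hg
  refine key.trans ?_
  have c1 : ∑' i, ∑' j, a i j * ENNReal.ofReal (dist (x i) (y j) ^ p) =
      ∫⁻ z, (∑' i, ∑' j, wt x i z.1 * wt y j z.2) * ENNReal.ofReal (dist z.1 z.2 ^ p) ∂π := by
    simp only [← ENNReal.tsum_mul_right]
    rw [lintegral_tsum (fun i => (Measurable.tsum fun j =>
      mm (mm (mX i) (mY j)) (measurable_cost p)).aemeasurable)]
    refine tsum_congr fun i => ?_
    rw [lintegral_tsum (fun j => (mm (mm (mX i) (mY j)) (measurable_cost p)).aemeasurable)]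
    refine tsum_congr fun j => ?_
    rw [← lintegral_mul_const _ (mm (mX i) (mY j))]
    refine lintegral_congr fun z => ?_
    have e1 := wt_mul_congr x i z.1 (fun u => ENNReal.ofReal (dist u (y j) ^ p))
    have e2 := wt_mul_congr y j z.2 (fun u => ENNReal.ofReal (dist z.1 u ^ p))
    calc _ = wt y j z.2 * (wt x i z.1 * ENNReal.ofReal (dist (x i) (y j) ^ p)) := by ring
      _ = wt x i z.1 * (wt y j z.2 * ENNReal.ofReal (dist z.1 (y j) ^ p)) := by rw [e1]; ring
      _ = _ := by rw [e2]; ring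
  have c2 : ∑' i, r i * ENNReal.ofReal (persDist (x i) ^ p) =
      ∫⁻ z, (∑' i, wt x i z.1) * D z.2 * ENNReal.ofReal (persDist z.1 ^ p) ∂π := by
    simp only [← ENNReal.tsum_mul_right]
    have mP : Measurable fun z : Pt × Pt => ENNReal.ofReal (persDist z.1 ^ p) :=
      (measurable_pers p).comp measurable_fst
    rw [lintegral_tsum (fun i => (mm (mm (mX i) mD2) mP).aemeasurable)]
    refine tsum_congr fun i => ?_
    rw [← lintegral_mul_const _ (mm (mX i) mD2)]
    refine lintegral_congr fun z => ?_
    have e1 := wt_mul_congr x i z.1 (fun u => ENNReal.ofReal (persDist u ^ p))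
    rw [mul_right_comm, e1, mul_right_comm]
  have c3 : ∑' j, s j * ENNReal.ofReal (persDist (y j) ^ p) =
      ∫⁻ z, D z.1 * (∑' j, wt y j z.2) * ENNReal.ofReal (persDist z.2 ^ p) ∂π := by
    simp only [← ENNReal.tsum_mul_right, ← ENNReal.tsum_mul_left]
    have mP : Measurable fun z : Pt × Pt => ENNReal.ofReal (persDist z.2 ^ p) :=
      (measurable_pers p).comp measurable_snd
    rw [lintegral_tsum (fun i => (mm (mm mD1 (mY i)) mP).aemeasurable)]
    refine tsum_congr fun i => ?_
    rw [← lintegral_mul_const _ (mm mD1 (mY i))]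
    refine lintegral_congr fun z => ?_
    have e1 := wt_mul_congr y i z.2 (fun u => ENNReal.ofReal (persDist u ^ p))
    rw [mul_assoc, e1, mul_assoc]
  change ∑' i, ∑' j, a i j * ENNReal.ofReal (dist (x i) (y j) ^ p) +
    ∑' i, r i * ENNReal.ofReal (persDist (x i) ^ p) +
    ∑' j, s j * ENNReal.ofReal (persDist (y j) ^ p) ≤ _
  rw [c1, c2, c3]
  simp only [ENNReal.tsum_mul_left, ENNReal.tsum_mul_right, tsum_wt x hxd, tsum_wt y hyd]
  have mRX : Measurable ((range x).indicator (1 : Pt → ℝ≥0∞)) :=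
    measurable_one.indicator (countable_range x).measurableSet
  have mRY : Measurable ((range y).indicator (1 : Pt → ℝ≥0∞)) :=
    measurable_one.indicator (countable_range y).measurableSet
  have mRX1 : Measurable fun z : Pt × Pt => (range x).indicator (1 : Pt → ℝ≥0∞) z.1 :=
    mRX.comp measurable_fst
  have mRY2 : Measurable fun z : Pt × Pt => (range y).indicator (1 : Pt → ℝ≥0∞) z.2 :=
    mRY.comp measurable_snd
  have mP2 : Measurable fun z : Pt × Pt => ENNReal.ofReal (persDist z.2 ^ p) :=
    (measurable_pers p).comp measurable_snd
  rw [← lintegral_add_left (mm (mm mRX1 mRY2) (measurable_cost p)),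
    ← lintegral_add_right _ (mm (mm mD1 mRY2) mP2)]
  refine lintegral_mono fun z => ?_
  have dX : ∀ u ∈ range x, u ∉ Diag := by
    rintro _ ⟨i, rfl⟩ h
    exact notMem_UHP_of_Diag h (hx i)
  have dY : ∀ u ∈ range y, u ∉ Diag := by
    rintro _ ⟨i, rfl⟩ h
    exact notMem_UHP_of_Diag h (hy i)
  have pn : ∀ u, 0 ≤ persDist u := fun u => infDist_nonneg
  have i1 : z.2 ∈ Diag → ENNReal.ofReal (persDist z.1 ^ p) ≤ ENNReal.ofReal (dist z.1 z.2 ^ p) :=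
    fun h => ENNReal.ofReal_le_ofReal (Real.rpow_le_rpow (pn _) (infDist_le_dist_of_mem h) hp)
  have i2 : z.1 ∈ Diag → ENNReal.ofReal (persDist z.2 ^ p) ≤ ENNReal.ofReal (dist z.1 z.2 ^ p) :=
    fun h => ENNReal.ofReal_le_ofReal (Real.rpow_le_rpow (pn _)
      (by rw [dist_comm]; exact infDist_le_dist_of_mem h) hp)
  by_cases hz1 : z.1 ∈ range x
  · have q1 : D z.1 = 0 := indicator_of_notMem (dX _ hz1) _
    rw [q1, indicator_of_mem hz1]
    by_cases hz2 : z.2 ∈ range y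
    · have q2 : D z.2 = 0 := indicator_of_notMem (dY _ hz2) _
      rw [q2, indicator_of_mem hz2]; simp
    · rw [indicator_of_notMem hz2]
      by_cases hd : z.2 ∈ Diag
      · simpa [D, hd] using i1 hd
      · simp [D, hd]
  · rw [indicator_of_notMem hz1]
    by_cases hd : z.1 ∈ Diag
    · by_cases hz2 : z.2 ∈ range y
      · simpa [D, hd, indicator_of_mem hz2] using i2 hd
      · simp [indicator_of_notMem hz2]
    · simp [D, hd]

/-- for persistence diagrams a,b ∈ D^p, OT_p(a,b)^p equals the infimum
over partial matchings of the p-th matching cost (i.e. OT_p = d_p). -/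
theorem stmt5 (p : ℝ) (hp : 1 ≤ p) {ι κ : Type} [Countable ι] [Countable κ]
    (x : ι → Pt) (y : κ → Pt) (hx : ∀ i, x i ∈ UHP) (hy : ∀ j, y j ∈ UHP)
    (hxd : IsDiagram (famMeasure x)) (hyd : IsDiagram (famMeasure y))
    (ha : MemMp p (famMeasure x)) (hb : MemMp p (famMeasure y)) :
    OTe p (famMeasure x) (famMeasure y) = ⨅ m : Matching ι κ, mCost p x y m := by
  have hp0 : 0 ≤ p := le_trans zero_le_one hp
  refine le_antisymm (le_iInf fun m => OTe_le p x y hx hy m) ?_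
  refine le_iInf₂ fun π hπ => le_Cost p x y hx hy hxd hyd hp0 ?_ ?_ π hπ
  · rw [← Pers_fam p x hx]; exact ha.2.ne
  · rw [← Pers_fam p y hy]; exact hb.2.ne
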